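/- For each positive integer n, the matrix algebra (M_n(𝔽), 𝔽, ×, +_𝔽, |·|) is not an e⃗-Ramsey algebra for any nonconstant e⃗ ∈ Ω_0. -/

import Mathlib

universe u v

/-- A (heterogeneous) operation: a list of input sorts, an output sort, and an
underlying function on lists of elements (only its values on lists of the right
length and sorts matter). -/
structure HetOp (I : Type u) (U : Type v) where
  inSorts : List I
  outSort : I
  fn : List U → U

namespace HetRamsey

variable {I : Type u} {U : Type v}

/-- `f` maps the phyla prescribed by its input sorts into the phylum of its output sort. -/
def WellSorted (A : I → Set U) (f : HetOp I U) : Prop :=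
  ∀ xs : List U, List.Forall₂ (fun x ξ => x ∈ A ξ) xs f.inSorts → f.fn xs ∈ A f.outSort

/-- Apply the operations in `hs` to consecutive chunks of the list `xs`. -/
def applyChunks : List (HetOp I U) → List U → List U
  | [], _ => []
  | h :: t, xs => h.fn (xs.take h.inSorts.length) :: applyChunks t (xs.drop h.inSorts.length)

/-- The orderly terms over a family `F` of operations: `F` itself, the identity
operations, closed under orderly composition. -/
inductive OT (F : Set (HetOp I U)) : HetOp I U → Prop
  | base {f : HetOp I U} : f ∈ F → OT F f
  | id (ξ : I) (c : HetOp I U) :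
      c.inSorts = [ξ] → c.outSort = ξ → (∀ x : U, c.fn [x] = x) → OT F c
  | comp (g : HetOp I U) (hs : List (HetOp I U)) :
      g ∈ F → (∀ h ∈ hs, OT F h) →
      List.Forall₂ (fun (h : HetOp I U) ξ => h.outSort = ξ) hs g.inSorts →
      OT F ⟨(hs.map HetOp.inSorts).flatten, g.outSort, fun xs => g.fn (applyChunks hs xs)⟩

/-- `b` is `e`-sorted: the `i`-th term lies in phylum `A (e i)`. -/
def Sorted (A : I → Set U) (e : ℕ → I) (b : ℕ → U) : Prop :=
  ∀ i, b i ∈ A (e i)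

/-- `a` is a reduction of `b` with respect to the family of operations `F`:
each term `a j` is obtained by applying an orderly term over `F` to a finite
subsequence of `b`, and these finite subsequences concatenate to a
subsequence of `b`. -/
def Reduction (A : I → Set U) (F : Set (HetOp I U)) (a b : ℕ → U) : Prop :=
  ∃ (φ : ℕ → List ℕ) (f : ℕ → HetOp I U),
    (∀ j, OT F (f j)) ∧
    (∀ j, (φ j).Chain' (· < ·)) ∧
    (∀ j k, j < k → ∀ x ∈ φ j, ∀ y ∈ φ k, x < y) ∧
    (∀ j, List.Forall₂ (fun i ξ => b i ∈ A ξ) (φ j) (f j).inSorts) ∧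
    (∀ j, a j = (f j).fn ((φ j).map b))

/-- `FR^e_F(b)`: the set of first terms of `e`-sorted reductions of `b`. -/
def FR (A : I → Set U) (F : Set (HetOp I U)) (e : ℕ → I) (b : ℕ → U) : Set U :=
  { x | ∃ a : ℕ → U, Reduction A F a b ∧ Sorted A e a ∧ a 0 = x }

/-- The algebra with phyla `A` and operations `F` is an `e`-Ramsey algebra. -/
def IsERamsey (A : I → Set U) (F : Set (HetOp I U)) (e : ℕ → I) : Prop :=
  ∀ b : ℕ → U, Sorted A e b → ∀ X : Set U, X ⊆ A (e 0) →
    ∃ a : ℕ → U, Reduction A F a b ∧ Sorted A e a ∧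
      (FR A F e a ⊆ X ∨ FR A F e a ∩ X = ∅)

/-- The homogeneous algebra `(A ξ, F)` is a Ramsey algebra: it is `e`-Ramsey for
the constant sort with value `ξ`. -/
def IsRamsey (A : I → Set U) (F : Set (HetOp I U)) (ξ : I) : Prop :=
  IsERamsey A F fun _ => ξ

/-- For a homogeneous algebra: `FR_G(α) = { f(τ) : f ∈ OT(G), τ a finite subsequence of α }`. -/
def FRfin (A : I → Set U) (G : Set (HetOp I U)) (α : ℕ → U) : Set U :=
  { x | ∃ (f : HetOp I U) (ns : List ℕ), OT G f ∧ ns.Chain' (· < ·) ∧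
      List.Forall₂ (fun i ξ => α i ∈ A ξ) ns f.inSorts ∧ x = f.fn (ns.map α) }

/-- `e ∈ Ω`: every value attained by the sort `e` is attained infinitely often. -/
def InOmega (e : ℕ → I) : Prop :=
  ∀ i, {j | e j = e i}.Infinite

end HetRamsey
namespace HetRamsey

/-- The underlying universe of a matrix algebra: scalars (left) and matrices (right). -/
abbrev MatU (𝔽 : Type) (n : ℕ) : Type := 𝔽 ⊕ Matrix (Fin n) (Fin n) 𝔽

/-- The two phyla: index `0` is the scalar phylum `𝔽`, index `1` the matrix phylum. -/
def matPhyla (𝔽 : Type) (n : ℕ) : Fin 2 → Set (MatU 𝔽 n) :=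
  fun i => if i = 0 then Set.range Sum.inl else Set.range Sum.inr

def toScal {𝔽 : Type} [Zero 𝔽] {n : ℕ} : MatU 𝔽 n → 𝔽
  | Sum.inl r => r
  | Sum.inr _ => 0

def toMat {𝔽 : Type} [Zero 𝔽] {n : ℕ} : MatU 𝔽 n → Matrix (Fin n) (Fin n) 𝔽
  | Sum.inl _ => 0
  | Sum.inr m => m

/-- Matrix addition as a heterogeneous operation. -/
def matAddOp (𝔽 : Type) [Field 𝔽] (n : ℕ) : HetOp (Fin 2) (MatU 𝔽 n) :=
  ⟨[1, 1], 1, fun xs => match xs with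
    | [x, y] => Sum.inr (toMat x + toMat y)
    | _ => Sum.inl 0⟩

/-- Matrix multiplication as a heterogeneous operation. -/
def matMulOp (𝔽 : Type) [Field 𝔽] (n : ℕ) : HetOp (Fin 2) (MatU 𝔽 n) :=
  ⟨[1, 1], 1, fun xs => match xs with
    | [x, y] => Sum.inr (toMat x * toMat y)
    | _ => Sum.inl 0⟩

/-- Field addition as a heterogeneous operation. -/
def scalAddOp (𝔽 : Type) [Field 𝔽] (n : ℕ) : HetOp (Fin 2) (MatU 𝔽 n) :=
  ⟨[0, 0], 0, fun xs => match xs with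
    | [x, y] => Sum.inl (toScal x + toScal y)
    | _ => Sum.inl 0⟩

/-- Field multiplication as a heterogeneous operation. -/
def scalMulOp (𝔽 : Type) [Field 𝔽] (n : ℕ) : HetOp (Fin 2) (MatU 𝔽 n) :=
  ⟨[0, 0], 0, fun xs => match xs with
    | [x, y] => Sum.inl (toScal x * toScal y)
    | _ => Sum.inl 0⟩

/-- The determinant as a heterogeneous operation from the matrix phylum to the scalar phylum. -/
def detOp (𝔽 : Type) [Field 𝔽] (n : ℕ) : HetOp (Fin 2) (MatU 𝔽 n) :=
  ⟨[1], 0, fun xs => match xs with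
    | [x] => Sum.inl (toMat x).det
    | _ => Sum.inl 0⟩

end HetRamsey

open HetRamsey

namespace HetRamsey

variable {I : Type u} {U : Type v}

/-- Chunkwise application of well-sorted operations produces a list of the output sorts. -/
theorem forall₂_applyChunks {A : I → Set U} (hs : List (HetOp I U))
    (hw : ∀ h ∈ hs, WellSorted A h) (xs : List U)
    (hx : List.Forall₂ (fun x ξ => x ∈ A ξ) xs (hs.map HetOp.inSorts).flatten) :
    List.Forall₂ (fun x ξ => x ∈ A ξ) (applyChunks hs xs) (hs.map HetOp.outSort) := by
  induction hs generalizing xs with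
  | nil => exact List.Forall₂.nil
  | cons h t ih =>
    rw [List.map_cons, List.flatten_cons] at hx
    have htake := List.forall₂_take h.inSorts.length hx
    have hdrop := List.forall₂_drop h.inSorts.length hx
    rw [List.take_left] at htake
    rw [List.drop_left] at hdrop
    exact List.Forall₂.cons (hw h (by simp) _ htake)
      (ih (fun h' hh' => hw h' (List.mem_cons_of_mem _ hh')) _ hdrop)

/-- A family of subsets preserved by the basic operations is preserved by all orderly terms. -/
theorem OT.wellSorted {A : I → Set U} {F : Set (HetOp I U)} (hF : ∀ f ∈ F, WellSorted A f)
    {f : HetOp I U} (hf : OT F f) : WellSorted A f := by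
  induction hf with
  | base h => exact hF _ h
  | id ξ c hin hout hc =>
    intro xs hx
    rw [hin] at hx
    obtain ⟨x, l, hxξ, hl, rfl⟩ := List.forall₂_cons_right_iff.1 hx
    rw [List.forall₂_nil_right_iff] at hl
    subst hl
    rw [hc, hout]
    exact hxξ
  | comp g hs hg _ hout ih =>
    intro xs hx
    have key := forall₂_applyChunks hs ih xs hx
    have hmap : hs.map HetOp.outSort = g.inSorts := by
      rw [← List.forall₂_eq_eq_eq, List.forall₂_map_left_iff]
      exact hout
    rw [hmap] at key
    exact hF g hg _ key

/-- For `e ∈ Ω`, every value in phylum `A (e 0)` of an orderly term at a finite subsequence of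
an `e`-sorted sequence `a` belongs to `FR A F e a`. -/
theorem mem_FR_of_OT {A : I → Set U} {F : Set (HetOp I U)} {e : ℕ → I} (he : InOmega e)
    {a : ℕ → U} (ha : Sorted A e a) {f : HetOp I U} (hf : OT F f) {ns : List ℕ}
    (hns : ns.IsChain (· < ·)) (hin : List.Forall₂ (fun i ξ => a i ∈ A ξ) ns f.inSorts)
    (hout : f.fn (ns.map a) ∈ A (e 0)) : f.fn (ns.map a) ∈ FR A F e a := by
  have hnext : ∀ j N, ∃ m, N < m ∧ e m = e j := fun j N => by
    obtain ⟨m, hm, hN⟩ := (he j).exists_gt N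
    exact ⟨m, hN, hm⟩
  choose g hg hge using hnext
  let m : ℕ → ℕ := fun j => Nat.rec ns.sum (fun j r => g (j + 1) r) j
  have hm : StrictMono m := strictMono_nat_of_lt_succ fun j => hg _ _
  have hme : ∀ j, e (m (j + 1)) = e (j + 1) := fun j => hge _ _
  have hm0 : ∀ x ∈ ns, x ≤ m 0 := fun x hx => List.le_sum_of_mem hx
  let ident : I → HetOp I U := fun ξ => ⟨[ξ], ξ, fun xs => xs.headD (a 0)⟩
  refine ⟨fun j => Nat.casesOn j (f.fn (ns.map a)) fun j => a (m (j + 1)),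
    ⟨fun j => Nat.casesOn j ns fun j => [m (j + 1)],
      fun j => Nat.casesOn j f fun j => ident (e (j + 1)), ?_, ?_, ?_, ?_, ?_⟩, ?_, rfl⟩
  · rintro (_ | j)
    · exact hf
    · exact OT.id (e (j + 1)) _ rfl rfl fun _ => rfl
  · rintro (_ | j)
    · exact hns
    · exact List.isChain_singleton _
  · rintro (_ | j) (_ | k) hjk x hx y hy
    · omega
    · obtain rfl := List.mem_singleton.1 hy
      exact (hm0 x hx).trans_lt (hm (Nat.succ_pos k))
    · omega
    · obtain rfl := List.mem_singleton.1 hx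
      obtain rfl := List.mem_singleton.1 hy
      exact hm hjk
  · rintro (_ | j)
    · exact hin
    · exact List.Forall₂.cons (hme j ▸ ha (m (j + 1))) List.Forall₂.nil
  · rintro (_ | j) <;> rfl
  · rintro (_ | j)
    · exact hout
    · exact hme j ▸ ha (m (j + 1))

/-- The subfamily of `matPhyla` whose only matrix is the identity. -/
def scalOnePhyla (𝔽 : Type) [Field 𝔽] (n : ℕ) : Fin 2 → Set (MatU 𝔽 n) :=
  fun i => if i = 0 then Set.range Sum.inl else {Sum.inr 1}

theorem wellSorted_scalOnePhyla (𝔽 : Type) [Field 𝔽] (n : ℕ) :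
    ∀ f ∈ ({matMulOp 𝔽 n, scalAddOp 𝔽 n, detOp 𝔽 n} : Set (HetOp (Fin 2) (MatU 𝔽 n))),
      WellSorted (scalOnePhyla 𝔽 n) f := by
  rintro f (rfl | rfl | rfl) xs hx
  · obtain ⟨x, l, h1, hl, rfl⟩ := List.forall₂_cons_right_iff.1 hx
    obtain ⟨y, l, h2, hl', rfl⟩ := List.forall₂_cons_right_iff.1 hl
    obtain rfl := List.forall₂_nil_right_iff.1 hl'
    simp only [scalOnePhyla, one_ne_zero, if_false, Set.mem_singleton_iff] at h1 h2
    subst h1 h2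
    simp [scalOnePhyla, matMulOp, toMat]
  · obtain ⟨x, l, h1, hl, rfl⟩ := List.forall₂_cons_right_iff.1 hx
    obtain ⟨y, l, h2, hl', rfl⟩ := List.forall₂_cons_right_iff.1 hl
    obtain rfl := List.forall₂_nil_right_iff.1 hl'
    simp [scalOnePhyla, scalAddOp]
  · obtain ⟨x, l, h1, hl, rfl⟩ := List.forall₂_cons_right_iff.1 hx
    obtain rfl := List.forall₂_nil_right_iff.1 hl
    simp [scalOnePhyla, detOp]

/-- Any matrix obtained by an orderly term from scalars and identity matrices is the identity. -/
theorem eq_one_of_reduction {𝔽 : Type} [Field 𝔽] {n : ℕ} {e : ℕ → Fin 2} {a b : ℕ → MatU 𝔽 n}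
    (hb : Sorted (scalOnePhyla 𝔽 n) e b)
    (hab : Reduction (matPhyla 𝔽 n) {matMulOp 𝔽 n, scalAddOp 𝔽 n, detOp 𝔽 n} a b)
    {j : ℕ} (hj : a j ∈ matPhyla 𝔽 n 1) : a j = Sum.inr 1 := by
  obtain ⟨φ, f, hf, -, -, hin, hout⟩ := hab
  have hlift : ∀ i ξ, b i ∈ matPhyla 𝔽 n ξ → b i ∈ scalOnePhyla 𝔽 n ξ := by
    intro i ξ h
    have hbi := hb i
    generalize e i = η at hbi
    generalize b i = x at h hbi
    rcases x with r | m <;> fin_cases ξ <;> fin_cases η <;> simp_all [matPhyla, scalOnePhyla]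
  have hmem : a j ∈ scalOnePhyla 𝔽 n (f j).outSort := by
    rw [hout j]
    refine (hf j).wellSorted (wellSorted_scalOnePhyla 𝔽 n) _ ?_
    rw [List.forall₂_map_left_iff]
    exact (hin j).imp hlift
  generalize (f j).outSort = η at hmem
  fin_cases η
  · obtain ⟨r, hr⟩ : ∃ r, Sum.inl r = a j := by simpa [scalOnePhyla] using hmem
    rw [← hr] at hj
    simp [matPhyla] at hj
  · simpa [scalOnePhyla] using hmem

end HetRamsey

/-- for nonconstant `e ∈ Ω₀`, the matrix algebra
`(Mₙ(𝔽), 𝔽, ×, +_𝔽, |·|)` is not an `e`-Ramsey algebra. -/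
theorem matMul_scalAdd_det_not_eRamsey
    (𝔽 : Type) [Field 𝔽] [CharZero 𝔽] (n : ℕ) (hn : 0 < n)
    (e : ℕ → Fin 2) (he : InOmega e) (he0 : e 0 = 0)
    (hnc : ∃ i j, e i ≠ e j) :
    ¬ IsERamsey (matPhyla 𝔽 n) {matMulOp 𝔽 n, scalAddOp 𝔽 n, detOp 𝔽 n} e := by
  intro h
  obtain ⟨i, hi⟩ : ∃ i, e i = 1 := by
    obtain ⟨i, j, hij⟩ := hnc
    by_contra! hne
    have hzero : ∀ k, e k = 0 := fun k => by
      have := hne k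
      omega
    exact hij ((hzero i).trans (hzero j).symm)
  obtain ⟨k, hk, hik⟩ := (he i).exists_gt i
  have hk1 : e k = 1 := hk.trans hi
  let b : ℕ → MatU 𝔽 n := fun j => if e j = 0 then Sum.inl 0 else Sum.inr 1
  have hb : Sorted (matPhyla 𝔽 n) e b := fun j => by
    by_cases hj : e j = 0 <;> simp [b, hj, matPhyla]
  have hb' : Sorted (scalOnePhyla 𝔽 n) e b := fun j => by
    by_cases hj : e j = 0 <;> simp [b, hj, scalOnePhyla]
  obtain ⟨a, hab, ha, hX⟩ := h b hb {Sum.inl 1} (by simp [he0, matPhyla])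
  have hai := ha i
  have hak := ha k
  rw [hi] at hai
  rw [hk1] at hak
  have hi1 : a i = Sum.inr 1 := eq_one_of_reduction hb' hab hai
  have hk1 : a k = Sum.inr 1 := eq_one_of_reduction hb' hab hak
  have hdet : OT {matMulOp 𝔽 n, scalAddOp 𝔽 n, detOp 𝔽 n} (detOp 𝔽 n) := OT.base (by simp)
  have hone : Sum.inl 1 ∈
      FR (matPhyla 𝔽 n) {matMulOp 𝔽 n, scalAddOp 𝔽 n, detOp 𝔽 n} e a := by
    have := mem_FR_of_OT he ha hdet (ns := [i]) (List.isChain_singleton _)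
      (List.Forall₂.cons hai List.Forall₂.nil) (by simp [he0, matPhyla, detOp])
    simpa [detOp, hi1, toMat] using this
  have htwo : Sum.inl (1 + 1) ∈
      FR (matPhyla 𝔽 n) {matMulOp 𝔽 n, scalAddOp 𝔽 n, detOp 𝔽 n} e a := by
    have hadd := OT.comp (F := {matMulOp 𝔽 n, scalAddOp 𝔽 n, detOp 𝔽 n}) (scalAddOp 𝔽 n)
      [detOp 𝔽 n, detOp 𝔽 n] (by simp) (by simpa using hdet) (by simp [scalAddOp, detOp])
    have := mem_FR_of_OT he ha hadd (ns := [i, k]) (List.isChain_pair.2 hik)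
      (List.Forall₂.cons hai (List.Forall₂.cons hak List.Forall₂.nil))
      (by simp [he0, matPhyla, scalAddOp, detOp, applyChunks])
    simpa [scalAddOp, detOp, applyChunks, hi1, hk1, toMat, toScal] using this
  rcases hX with hX | hX
  · simpa using hX htwo
  · exact Set.eq_empty_iff_forall_notMem.1 hX _ ⟨hone, rfl⟩
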